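/- With the lexicographic ordering of smash products, the category Fskel is a permutative category: the assignments m ⊗ n = m·n on objects and f ⊗ g = f ∧ g on morphisms define a functor Fskel × Fskel → Fskel which is strictly associative and strictly unital with unit the object 1, and the maps ξ_{m,n} are the components of a braiding making Fskel a symmetric monoidal category whose associator and unitors are identities. -/

import Mathlib

/-- The pointed finite set `⟨n⟩ = {0,1,…,n}` with basepoint `0`, realized as `Fin (n+1)`. -/
abbrev Pt (n : ℕ) : Type := Fin (n + 1)

/-- The lexicographic pairing `L_{m,n} : ⟨m⟩ × ⟨n⟩ → ⟨m·n⟩`, given by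
`L(x,y) = 0` if `x = 0` or `y = 0`, and `L(x,y) = n·(x−1)+y` otherwise. -/
def lexL (m n : ℕ) (x : Pt m) (y : Pt n) : Pt (m * n) :=
  if h : x.val = 0 ∨ y.val = 0 then 0
  else ⟨n * (x.val - 1) + y.val, by
    push_neg at h
    obtain ⟨hx, hy⟩ := h
    have hxm : x.val ≤ m := Nat.lt_succ_iff.mp x.isLt
    have hyn : y.val ≤ n := Nat.lt_succ_iff.mp y.isLt
    have h1 : n * (x.val - 1) ≤ n * (m - 1) :=
      Nat.mul_le_mul_left _ (by omega)
    have h2 : n * (m - 1) + n = n * m := by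
      rw [← Nat.mul_succ]
      congr 1
      omega
    have h3 : n * m = m * n := Nat.mul_comm n m
    omega⟩


/-- First coordinate of the inverse of the lexicographic pairing. -/
def unL1 (m n : ℕ) (z : Pt (m * n)) : Pt m :=
  if hz : z.val = 0 then 0
  else ⟨(z.val - 1) / n + 1, by
    have hzl : z.val ≤ m * n := Nat.lt_succ_iff.mp z.isLt
    have hn : 0 < n := by
      rcases Nat.eq_zero_or_pos n with h | h
      · exfalso
        have h0 : m * n = 0 := by rw [h, Nat.mul_zero]
        omega
      · exact h
    have : (z.val - 1) / n < m := by
      rw [Nat.div_lt_iff_lt_mul hn]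
      omega
    omega⟩

/-- Second coordinate of the inverse of the lexicographic pairing. -/
def unL2 (m n : ℕ) (z : Pt (m * n)) : Pt n :=
  if hz : z.val = 0 then 0
  else ⟨(z.val - 1) % n + 1, by
    have hzl : z.val ≤ m * n := Nat.lt_succ_iff.mp z.isLt
    have hn : 0 < n := by
      rcases Nat.eq_zero_or_pos n with h | h
      · exfalso
        have h0 : m * n = 0 := by rw [h, Nat.mul_zero]
        omega
      · exact h
    have := Nat.mod_lt (z.val - 1) hn
    omega⟩

/-- The smash product `f ∧ g` of maps in lexicographic coordinates. -/
def smashMap {m n m' n' : ℕ} (f : Pt m → Pt m') (g : Pt n → Pt n') :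
    Pt (m * n) → Pt (m' * n') :=
  fun z => lexL m' n' (f (unL1 m n z)) (g (unL2 m n z))

/-- The lexicographic braiding `ξ_{m,n} : ⟨m·n⟩ → ⟨n·m⟩`. -/
def xiMap (m n : ℕ) : Pt (m * n) → Pt (n * m) :=
  fun z => lexL n m (unL2 m n z) (unL1 m n z)

lemma lexL_zero_left (m n : ℕ) (y : Pt n) : lexL m n 0 y = 0 := by
  simp [lexL]

lemma unL1_zero (m n : ℕ) : unL1 m n 0 = 0 := by simp [unL1]

lemma unL2_zero (m n : ℕ) : unL2 m n 0 = 0 := by simp [unL2]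

open CategoryTheory

/-- The category `Fskel`: objects are natural numbers `n`, standing for the pointed
finite sets `⟨n⟩`, and morphisms are basepoint-preserving functions. -/
structure Fskel where
  n : ℕ

instance : Category Fskel where
  Hom a b := {f : Pt a.n → Pt b.n // f 0 = 0}
  id a := ⟨id, rfl⟩
  comp f g := ⟨g.1 ∘ f.1, by show g.1 (f.1 0) = 0; rw [f.2, g.2]⟩
  id_comp f := Subtype.ext rfl
  comp_id f := Subtype.ext rfl
  assoc f g h := Subtype.ext rfl

/-- The smash product of morphisms of `Fskel`, in lexicographic coordinates. -/
def smashHom {a b c d : Fskel} (f : a ⟶ b) (g : c ⟶ d) :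
    Fskel.mk (a.n * c.n) ⟶ Fskel.mk (b.n * d.n) :=
  ⟨smashMap f.1 g.1, by
    show lexL _ _ (f.1 (unL1 _ _ 0)) (g.1 (unL2 _ _ 0)) = 0
    rw [unL1_zero, unL2_zero, f.2, g.2, lexL_zero_left]⟩

/-- The braiding morphism of `Fskel`. -/
def xiHom (a b : Fskel) : Fskel.mk (a.n * b.n) ⟶ Fskel.mk (b.n * a.n) :=
  ⟨xiMap a.n b.n, by
    show lexL _ _ (unL2 _ _ 0) (unL1 _ _ 0) = 0
    rw [unL1_zero, unL2_zero, lexL_zero_left]⟩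

/-- The property of being a permutative category: a given tensor product
(on objects and morphisms), unit object, and braiding make the category a
symmetric monoidal category whose associator and unitors are identities. -/
structure IsPermutative (C : Type*) [Category C]
    (tObj : C → C → C)
    (tHom : ∀ {a b c d : C}, (a ⟶ b) → (c ⟶ d) → (tObj a c ⟶ tObj b d))
    (e : C)
    (β : ∀ a b : C, tObj a b ⟶ tObj b a) : Prop where
  /-- functoriality of the tensor: identities -/
  tensor_id : ∀ a b : C, tHom (𝟙 a) (𝟙 b) = 𝟙 (tObj a b)
  /-- functoriality of the tensor: composition -/
  tensor_comp : ∀ {a b c a' b' c' : C} (f : a ⟶ b) (g : b ⟶ c)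
    (f' : a' ⟶ b') (g' : b' ⟶ c'),
    tHom (f ≫ g) (f' ≫ g') = tHom f f' ≫ tHom g g'
  /-- strict associativity on objects -/
  assoc_obj : ∀ a b c : C, tObj (tObj a b) c = tObj a (tObj b c)
  /-- strict associativity on morphisms (the associator is the identity) -/
  assoc_hom : ∀ {a b c a' b' c' : C} (f : a ⟶ a') (g : b ⟶ b') (h : c ⟶ c'),
    tHom (tHom f g) h ≫ eqToHom (assoc_obj a' b' c')
      = eqToHom (assoc_obj a b c) ≫ tHom f (tHom g h)
  /-- strict left unitality on objects -/
  unit_left_obj : ∀ a : C, tObj e a = a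
  /-- strict left unitality on morphisms (the left unitor is the identity) -/
  unit_left_hom : ∀ {a b : C} (f : a ⟶ b),
    tHom (𝟙 e) f ≫ eqToHom (unit_left_obj b) = eqToHom (unit_left_obj a) ≫ f
  /-- strict right unitality on objects -/
  unit_right_obj : ∀ a : C, tObj a e = a
  /-- strict right unitality on morphisms (the right unitor is the identity) -/
  unit_right_hom : ∀ {a b : C} (f : a ⟶ b),
    tHom f (𝟙 e) ≫ eqToHom (unit_right_obj b) = eqToHom (unit_right_obj a) ≫ f
  /-- naturality of the braiding -/
  braid_natural : ∀ {a b c d : C} (f : a ⟶ b) (g : c ⟶ d),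
    tHom f g ≫ β b d = β a c ≫ tHom g f
  /-- the symmetry axiom -/
  symmetry : ∀ a b : C, β a b ≫ β b a = 𝟙 (tObj a b)
  /-- the hexagon axiom (in strict form) -/
  hexagon : ∀ a b c : C,
    β a (tObj b c)
      = eqToHom (assoc_obj a b c).symm ≫ tHom (β a b) (𝟙 c) ≫ eqToHom (assoc_obj b a c)
        ≫ tHom (𝟙 b) (β a c) ≫ eqToHom (assoc_obj b c a).symm

lemma lexL_val (m n : ℕ) (x : Pt m) (y : Pt n) :
    (lexL m n x y).val = if x.val = 0 ∨ y.val = 0 then 0 else n * (x.val - 1) + y.val := by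
  unfold lexL
  split_ifs <;> rfl

lemma lexL_zero_right (m n : ℕ) (x : Pt m) : lexL m n x 0 = 0 := by
  simp [lexL]

lemma lexL_un (m n : ℕ) (z : Pt (m * n)) : lexL m n (unL1 m n z) (unL2 m n z) = z := by
  apply Fin.ext
  rw [lexL_val]
  by_cases hz : z.val = 0
  · simp [unL1, hz]
  · have h := Nat.div_add_mod (z.val - 1) n
    simp only [unL1, unL2, hz, dite_false]
    simp
    omega

lemma lexL_surj (m n : ℕ) (z : Pt (m * n)) : ∃ x y, lexL m n x y = z :=
  ⟨_, _, lexL_un m n z⟩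

lemma un_lexL (m n : ℕ) (x : Pt m) (y : Pt n) (hx : x ≠ 0) (hy : y ≠ 0) :
    unL1 m n (lexL m n x y) = x ∧ unL2 m n (lexL m n x y) = y := by
  have hx' : x.val ≠ 0 := fun h => hx (Fin.ext h)
  have hy' : y.val ≠ 0 := fun h => hy (Fin.ext h)
  have hyn : y.val ≤ n := Nat.lt_succ_iff.mp y.isLt
  have hv : (lexL m n x y).val = n * (x.val - 1) + y.val := by
    rw [lexL_val, if_neg (by tauto)]
  have hne : (lexL m n x y).val ≠ 0 := by omega
  have e : n * (x.val - 1) + y.val - 1 = (y.val - 1) + n * (x.val - 1) := by omega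
  constructor
  · apply Fin.ext
    simp only [unL1, hne, dite_false]
    simp only [hv]
    rw [e, Nat.add_mul_div_left _ _ (by omega), Nat.div_eq_of_lt (by omega)]
    omega
  · apply Fin.ext
    simp only [unL2, hne, dite_false]
    simp only [hv]
    rw [e, Nat.add_mul_mod_self_left, Nat.mod_eq_of_lt (by omega)]
    omega

lemma smashMap_lexL {m n m' n' : ℕ} (f : Pt m → Pt m') (g : Pt n → Pt n')
    (hf : f 0 = 0) (hg : g 0 = 0) (x : Pt m) (y : Pt n) :
    smashMap f g (lexL m n x y) = lexL m' n' (f x) (g y) := by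
  unfold smashMap
  by_cases hx : x = 0
  · subst hx
    rw [lexL_zero_left, unL1_zero, hf, lexL_zero_left, lexL_zero_left]
  by_cases hy : y = 0
  · subst hy
    rw [lexL_zero_right, unL2_zero, hg, lexL_zero_right, lexL_zero_right]
  rw [(un_lexL m n x y hx hy).1, (un_lexL m n x y hx hy).2]

lemma xiMap_lexL (m n : ℕ) (x : Pt m) (y : Pt n) :
    xiMap m n (lexL m n x y) = lexL n m y x := by
  unfold xiMap
  by_cases hx : x = 0
  · subst hx
    rw [lexL_zero_left, unL1_zero, lexL_zero_right, lexL_zero_right]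
  by_cases hy : y = 0
  · subst hy
    rw [lexL_zero_right, unL2_zero, lexL_zero_left, lexL_zero_left]
  rw [(un_lexL m n x y hx hy).1, (un_lexL m n x y hx hy).2]

lemma lexL_assoc (a b c : ℕ) (x : Pt a) (y : Pt b) (z : Pt c)
    (h : a * b * c + 1 = a * (b * c) + 1) :
    Fin.cast h (lexL (a * b) c (lexL a b x y) z) = lexL a (b * c) x (lexL b c y z) := by
  apply Fin.ext
  rw [Fin.val_cast]
  simp only [lexL_val]
  by_cases hx : x.val = 0
  · simp [hx]
  by_cases hy : y.val = 0
  · simp [hy]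
  by_cases hz : z.val = 0
  · simp [hz]
  obtain ⟨x', hx'⟩ := Nat.exists_eq_succ_of_ne_zero hx
  obtain ⟨y', hy'⟩ := Nat.exists_eq_succ_of_ne_zero hy
  obtain ⟨z', hz'⟩ := Nat.exists_eq_succ_of_ne_zero hz
  simp [hx', hy', hz']
  ring

lemma lexL_assoc' (a b c : ℕ) (x : Pt a) (y : Pt b) (z : Pt c)
    (h : a * (b * c) + 1 = a * b * c + 1) :
    Fin.cast h (lexL a (b * c) x (lexL b c y z)) = lexL (a * b) c (lexL a b x y) z := by
  rw [← lexL_assoc a b c x y z h.symm]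
  rfl

lemma lexL_one_left (n : ℕ) (y : Pt n) (h : 1 * n + 1 = n + 1) :
    Fin.cast h (lexL 1 n 1 y) = y := by
  apply Fin.ext
  rw [Fin.val_cast, lexL_val]
  simp
  intro h
  simp [h]

lemma lexL_one_right (n : ℕ) (x : Pt n) (h : n * 1 + 1 = n + 1) :
    Fin.cast h (lexL n 1 x 1) = x := by
  apply Fin.ext
  rw [Fin.val_cast, lexL_val]
  simp
  split_ifs with h
  · simp [h]
  · have : x.val ≠ 0 := fun h' => h (Fin.ext h')
    omega

lemma lexL_one_left_surj (n : ℕ) (z : Pt (1 * n)) : ∃ y, lexL 1 n 1 y = z := by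
  have h : 1 * n + 1 = n + 1 := by omega
  exact ⟨Fin.cast h z, Fin.cast_injective h (lexL_one_left n _ h)⟩

lemma lexL_one_right_surj (n : ℕ) (z : Pt (n * 1)) : ∃ x, lexL n 1 x 1 = z := by
  have h : n * 1 + 1 = n + 1 := by omega
  exact ⟨Fin.cast h z, Fin.cast_injective h (lexL_one_right n _ h)⟩

lemma Fskel_hom_ext {a b : Fskel} (f g : a ⟶ b) (h : ∀ x, f.1 x = g.1 x) : f = g :=
  Subtype.ext (funext h)

lemma Fskel_comp {a b c : Fskel} (f : a ⟶ b) (g : b ⟶ c) (x : Pt a.n) :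
    (f ≫ g).1 x = g.1 (f.1 x) := rfl

lemma Fskel_id (a : Fskel) (x : Pt a.n) : (𝟙 a : a ⟶ a).1 x = x := rfl

lemma Fskel_eqToHom {a b : Fskel} (h : a = b) (x : Pt a.n) :
    (eqToHom h).1 x = Fin.cast (by rw [h]) x := by
  subst h
  rfl

lemma smashHom_lexL {a b c d : Fskel} (f : a ⟶ b) (g : c ⟶ d) (x : Pt a.n) (y : Pt c.n) :
    (smashHom f g).1 (lexL a.n c.n x y) = lexL b.n d.n (f.1 x) (g.1 y) :=
  smashMap_lexL f.1 g.1 f.2 g.2 x y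

lemma xiHom_lexL (a b : Fskel) (x : Pt a.n) (y : Pt b.n) :
    (xiHom a b).1 (lexL a.n b.n x y) = lexL b.n a.n y x :=
  xiMap_lexL a.n b.n x y

/-- with the lexicographic ordering of smash products, `Fskel` is a
permutative category, with tensor `m ⊗ n = m·n` on objects, `f ⊗ g = f ∧ g` on
morphisms, unit `1`, and braiding `ξ`. -/
theorem statement6 :
    IsPermutative Fskel (fun a b => Fskel.mk (a.n * b.n))
      (fun f g => smashHom f g) (Fskel.mk 1) (fun a b => xiHom a b) := by
  refine
    { tensor_id := ?_
      tensor_comp := ?_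
      assoc_obj := fun a b c => congrArg Fskel.mk (Nat.mul_assoc _ _ _)
      assoc_hom := ?_
      unit_left_obj := fun a => congrArg Fskel.mk (Nat.one_mul _)
      unit_left_hom := ?_
      unit_right_obj := fun a => congrArg Fskel.mk (Nat.mul_one _)
      unit_right_hom := ?_
      braid_natural := ?_
      symmetry := ?_
      hexagon := ?_ }
  · intro a b
    apply Fskel_hom_ext
    intro w
    obtain ⟨x, y, rfl⟩ := lexL_surj _ _ w
    erw [smashHom_lexL]
    rfl
  · intro a b c a' b' c' f g f' g'
    apply Fskel_hom_ext
    intro w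
    obtain ⟨x, y, rfl⟩ := lexL_surj _ _ w
    exact (smashHom_lexL (f ≫ g) (f' ≫ g') x y).trans
      ((congrArg (smashHom g g').1 (smashHom_lexL f f' x y)).trans
        (smashHom_lexL g g' _ _)).symm
  · intro a b c a' b' c' f g h
    apply Fskel_hom_ext
    intro w
    obtain ⟨v, z, rfl⟩ := lexL_surj _ _ w
    obtain ⟨x, y, rfl⟩ := lexL_surj _ _ v
    rw [Fskel_comp, Fskel_comp, Fskel_eqToHom, Fskel_eqToHom]
    erw [smashHom_lexL, smashHom_lexL, lexL_assoc, lexL_assoc, smashHom_lexL, smashHom_lexL]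
  · intro a b f
    apply Fskel_hom_ext
    intro w
    obtain ⟨y, rfl⟩ := lexL_one_left_surj _ w
    rw [Fskel_comp, Fskel_comp, Fskel_eqToHom, Fskel_eqToHom]
    erw [smashHom_lexL, lexL_one_left, lexL_one_left]
  · intro a b f
    apply Fskel_hom_ext
    intro w
    obtain ⟨y, rfl⟩ := lexL_one_right_surj _ w
    rw [Fskel_comp, Fskel_comp, Fskel_eqToHom, Fskel_eqToHom]
    erw [smashHom_lexL, lexL_one_right, lexL_one_right]
  · intro a b c d f g
    apply Fskel_hom_ext
    intro w
    obtain ⟨x, y, rfl⟩ := lexL_surj _ _ w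
    rw [Fskel_comp, Fskel_comp]
    erw [smashHom_lexL, xiHom_lexL, xiHom_lexL, smashHom_lexL]
  · intro a b
    apply Fskel_hom_ext
    intro w
    obtain ⟨x, y, rfl⟩ := lexL_surj _ _ w
    exact (congrArg (xiHom b a).1 (xiHom_lexL a b x y)).trans (xiHom_lexL b a y x)
  · intro a b c
    apply Fskel_hom_ext
    intro w
    obtain ⟨x, v, rfl⟩ := lexL_surj _ _ w
    obtain ⟨y, z, rfl⟩ := lexL_surj _ _ v
    simp only [Fskel_comp, Fskel_eqToHom]
    have h1 := lexL_assoc' a.n b.n c.n x y z (by rw [Nat.mul_assoc])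
    have h2 : (smashHom (xiHom a b) (𝟙 c)).1 (lexL (a.n * b.n) c.n (lexL a.n b.n x y) z)
        = lexL (b.n * a.n) c.n (lexL b.n a.n y x) z :=
      (smashHom_lexL (xiHom a b) (𝟙 c) (lexL a.n b.n x y) z).trans
        (congrArg (fun t => lexL (b.n * a.n) c.n t z) (xiHom_lexL a b x y))
    have h3 := lexL_assoc b.n a.n c.n y x z (by rw [Nat.mul_assoc])
    have h4 : (smashHom (𝟙 b) (xiHom a c)).1 (lexL b.n (a.n * c.n) y (lexL a.n c.n x z))
        = lexL b.n (c.n * a.n) y (lexL c.n a.n z x) :=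
      (smashHom_lexL (𝟙 b) (xiHom a c) y (lexL a.n c.n x z)).trans
        (congrArg (fun t => lexL b.n (c.n * a.n) y t) (xiHom_lexL a c x z))
    have h5 := lexL_assoc' b.n c.n a.n y z x (by rw [Nat.mul_assoc])
    refine (xiHom_lexL a ⟨b.n * c.n⟩ x (lexL b.n c.n y z)).trans ?_
    refine h5.symm.trans (congrArg _ ?_)
    refine h4.symm.trans (congrArg _ ?_)
    refine h3.symm.trans (congrArg _ ?_)
    exact h2.symm.trans (congrArg _ h1.symm)
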